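/- Let S be a numerical semigroup with type t := t(S), multiplicity μ := μ(S) and Frobenius number g := g(S); suppose t ≥ 3 and g ≤ 2μ − 2. Then S ∪ {g} is an atom of G₀(S) if and only if S = ⟨4, 5, 6, 7⟩ = {0} ∪ {x ∈ ℕ : x ≥ 4}. -/

import Mathlib

/-- A numerical semigroup: a subset of ℕ containing 0, closed under addition,
with finite complement. -/
structure NumSgp where
  carrier : Set ℕ
  zero_mem : 0 ∈ carrier
  add_mem : ∀ a ∈ carrier, ∀ b ∈ carrier, a + b ∈ carrier
  cofinite : carrierᶜ.Finite

/-- The copy of `S` inside ℤ. -/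
def natS (S : NumSgp) : Set ℤ := (fun n : ℕ => (n : ℤ)) '' S.carrier

/-- A fractional ideal of `S`: a nonempty subset of ℤ, bounded below, with `I + S ⊆ I`. -/
def IsFracIdeal (S : NumSgp) (I : Set ℤ) : Prop :=
  I.Nonempty ∧ BddBelow I ∧ ∀ i ∈ I, ∀ s ∈ natS S, i + s ∈ I

/-- `(I − J) = {x ∈ ℤ : x + J ⊆ I}`. -/
def idealSub (I J : Set ℤ) : Set ℤ := {x : ℤ | ∀ j ∈ J, x + j ∈ I}

/-- `F₀(S)`: fractional ideals `I` with `S ⊆ I ⊆ ℕ` (hence with minimal element 0). -/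
def F0 (S : NumSgp) : Set (Set ℤ) :=
  {I | IsFracIdeal S I ∧ natS S ⊆ I ∧ I ⊆ {x : ℤ | 0 ≤ x}}

/-- The `v`-operation (divisorial closure): `I ↦ (S − (S − I))`. -/
def vOp (S : NumSgp) (I : Set ℤ) : Set ℤ := idealSub (natS S) (idealSub (natS S) I)

/-- An ideal is divisorial if it is `v`-closed. -/
def Divisorial (S : NumSgp) (I : Set ℤ) : Prop := vOp S I = I

/-- `G₀(S)`: the nondivisorial ideals in `F₀(S)`. -/
def G0 (S : NumSgp) : Set (Set ℤ) := {I | I ∈ F0 S ∧ ¬ Divisorial S I}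

/-- The action of the star operation `⋆_I` generated by `I`:
`J ↦ J^{⋆_I} = J^v ∩ (I − (I − J))`. -/
def starI (S : NumSgp) (I J : Set ℤ) : Set ℤ := vOp S J ∩ idealSub I (idealSub I J)

/-- The action of the star operation `⋆_Δ = inf_{I ∈ Δ} ⋆_I` generated by a set `Δ` of ideals:
`J ↦ J^{⋆_Δ} = J^v ∩ ⋂_{I ∈ Δ} (I − (I − J))`. -/
def starD (S : NumSgp) (Δ : Set (Set ℤ)) (J : Set ℤ) : Set ℤ :=
  vOp S J ∩ ⋂ I ∈ Δ, idealSub I (idealSub I J)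

/-- The ⋆-order: `I ≤⋆ J` iff `I` is `⋆_J`-closed. -/
def starle (S : NumSgp) (I J : Set ℤ) : Prop := starI S J I = I

/-- A star operation on `S`, given by its action on subsets of ℤ; it is normalized to be
the identity outside the fractional ideals, so that two star operations are equal iff they
agree on all fractional ideals. -/
structure StarOp (S : NumSgp) where
  toFun : Set ℤ → Set ℤ
  isFrac : ∀ I, IsFracIdeal S I → IsFracIdeal S (toFun I)
  subset_star : ∀ I, IsFracIdeal S I → I ⊆ toFun I
  mono : ∀ I J, IsFracIdeal S I → IsFracIdeal S J → I ⊆ J → toFun I ⊆ toFun J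
  idem : ∀ I, IsFracIdeal S I → toFun (toFun I) = toFun I
  transl : ∀ I, IsFracIdeal S I → ∀ a : ℤ,
    toFun ((fun x => a + x) '' I) = (fun x => a + x) '' toFun I
  star_S : toFun (natS S) = natS S
  default_eq : ∀ I, ¬ IsFracIdeal S I → toFun I = I

/-- The order on star operations: `s ≤ t` iff `I^s ⊆ I^t` for every fractional ideal `I`. -/
def StarOp.le {S : NumSgp} (s t : StarOp S) : Prop :=
  ∀ I, IsFracIdeal S I → s.toFun I ⊆ t.toFun I

/-- A star operation `s` is prime if whenever `s ≥ t ∧ u` (the infimum of two star operations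
being given by `I ↦ I^t ∩ I^u`), then `s ≥ t` or `s ≥ u`. -/
def StarOp.IsPrime {S : NumSgp} (s : StarOp S) : Prop :=
  ∀ t u : StarOp S,
    (∀ I, IsFracIdeal S I → t.toFun I ∩ u.toFun I ⊆ s.toFun I) →
    t.le s ∨ u.le s

/-- `I ∈ F₀(S)` is an atom if the star operation `⋆_I` is prime. -/
def AtomIdeal (S : NumSgp) (I : Set ℤ) : Prop :=
  I ∈ F0 S ∧ ∀ t u : StarOp S,
    (∀ J, IsFracIdeal S J → t.toFun J ∩ u.toFun J ⊆ starI S I J) →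
    (∀ J, IsFracIdeal S J → t.toFun J ⊆ starI S I J) ∨
    (∀ J, IsFracIdeal S J → u.toFun J ⊆ starI S I J)

/-- `M_a = {x ∈ ℕ : a − x ∉ S}`, the biggest ideal in `F₀(S)` not containing `a`. -/
def Mdual (S : NumSgp) (a : ℕ) : Set ℤ := {x : ℤ | 0 ≤ x ∧ ((a : ℤ) - x) ∉ natS S}

/-- `Q_a(S) = {I ∈ F₀(S) : a = sup(ℕ \ I), a ∈ I^v}`. -/
def Qa (S : NumSgp) (a : ℕ) : Set (Set ℤ) :=
  {I | I ∈ F0 S ∧ (a : ℤ) ∉ I ∧ (∀ x : ℤ, (a : ℤ) < x → x ∈ I) ∧ (a : ℤ) ∈ vOp S I}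

/-- The number of antichains (with respect to inclusion) of a family of ideals. -/
noncomputable def numInclAnti (Q : Set (Set ℤ)) : ℕ :=
  Set.ncard {Δ : Set (Set ℤ) | Δ ⊆ Q ∧ IsAntichain (· ⊆ ·) Δ}

/-- The `n`-th Dedekind number: the number of antichains of the power set of an
`n`-element set, ordered by inclusion. -/
noncomputable def dedekind (n : ℕ) : ℕ :=
  Nat.card {A : Set (Set (Fin n)) // IsAntichain (· ⊆ ·) A}

/-- `T(S) = (S − M_S) \ S`. -/
def Tset (S : NumSgp) : Set ℤ :=
  idealSub (natS S) ((fun n : ℕ => (n : ℤ)) '' (S.carrier \ {0})) \ natS S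

/-- The type `t(S) = |T(S)|`. -/
noncomputable def typeNum (S : NumSgp) : ℕ := (Tset S).ncard

/-- The Frobenius number `g(S)`: the largest integer not in `S`. -/
noncomputable def frob (S : NumSgp) : ℕ := sSup S.carrierᶜ

/-- The multiplicity `μ(S)`: the smallest nonzero element of `S`. -/
noncomputable def multNum (S : NumSgp) : ℕ := sInf (S.carrier \ {0})

/-- The degree of singularity `δ(S) = |ℕ \ S|`. -/
noncomputable def deltaNum (S : NumSgp) : ℕ := S.carrierᶜ.ncard

/-- `S` is symmetric if `g(S) − a ∈ S` for every `a ∈ ℕ \ S`. -/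
def IsSymmetricSgp (S : NumSgp) : Prop :=
  ∀ a : ℕ, a ∉ S.carrier → ((frob S : ℤ) - (a : ℤ)) ∈ natS S

theorem mem_natS {S : NumSgp} {x : ℤ} : x ∈ natS S ↔ ∃ n ∈ S.carrier, (n : ℤ) = x := by
  simp [natS]

theorem natS_cast {S : NumSgp} {n : ℕ} : (n : ℤ) ∈ natS S ↔ n ∈ S.carrier := by
  simp [natS]

theorem natS_nonneg {S : NumSgp} {x : ℤ} (h : x ∈ natS S) : 0 ≤ x := by
  obtain ⟨n, _, rfl⟩ := mem_natS.1 h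
  positivity

theorem natS_zero (S : NumSgp) : (0 : ℤ) ∈ natS S := mem_natS.2 ⟨0, S.zero_mem, rfl⟩

theorem natS_add {S : NumSgp} {x y : ℤ} (hx : x ∈ natS S) (hy : y ∈ natS S) :
    x + y ∈ natS S := by
  obtain ⟨n, hn, rfl⟩ := mem_natS.1 hx
  obtain ⟨m, hm, rfl⟩ := mem_natS.1 hy
  exact mem_natS.2 ⟨n + m, S.add_mem _ hn _ hm, by push_cast; rfl⟩

theorem gt_frob_mem {S : NumSgp} {n : ℕ} (h : frob S < n) : n ∈ S.carrier := by
  by_contra hn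
  have : n ≤ frob S := le_csSup S.cofinite.bddAbove hn
  omega

theorem gt_frob_natS {S : NumSgp} {x : ℤ} (h : (frob S : ℤ) < x) : x ∈ natS S := by
  refine mem_natS.2 ⟨x.toNat, gt_frob_mem (by omega), by omega⟩

theorem frob_not_mem {S : NumSgp} (h : S.carrierᶜ.Nonempty) : frob S ∉ S.carrier :=
  Nat.sSup_mem h S.cofinite.bddAbove

theorem mult_mem (S : NumSgp) : multNum S ∈ S.carrier \ {0} := by
  apply Nat.sInf_mem
  exact ⟨frob S + 1, gt_frob_mem (by omega), by simp⟩

theorem mult_le {S : NumSgp} {n : ℕ} (h : n ∈ S.carrier) (h0 : n ≠ 0) : multNum S ≤ n :=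
  Nat.sInf_le ⟨h, by simpa using h0⟩

theorem natS_isFrac (S : NumSgp) : IsFracIdeal S (natS S) :=
  ⟨⟨0, natS_zero S⟩, ⟨0, fun _ h => natS_nonneg h⟩, fun _ hi _ hs => natS_add hi hs⟩

theorem idealSub_anti {I J K : Set ℤ} (h : J ⊆ K) : idealSub I K ⊆ idealSub I J :=
  fun _ hx j hj => hx j (h hj)

theorem subset_dd (I K : Set ℤ) : K ⊆ idealSub I (idealSub I K) := by
  intro k hk x hx
  rw [add_comm]; exact hx k hk

theorem dddd (I K : Set ℤ) : idealSub I (idealSub I (idealSub I (idealSub I K))) ⊆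
    idealSub I (idealSub I K) :=
  idealSub_anti (subset_dd I (idealSub I K))

theorem subset_starI (S : NumSgp) (I K : Set ℤ) : K ⊆ starI S I K :=
  fun _ hx => ⟨subset_dd _ _ hx, subset_dd _ _ hx⟩

theorem starI_mono (S : NumSgp) (I : Set ℤ) {K L : Set ℤ} (h : K ⊆ L) :
    starI S I K ⊆ starI S I L :=
  fun _ hx => ⟨idealSub_anti (idealSub_anti h) hx.1, idealSub_anti (idealSub_anti h) hx.2⟩

theorem starI_idem (S : NumSgp) (I K : Set ℤ) : starI S I (starI S I K) = starI S I K := by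
  refine Set.Subset.antisymm ?_ (subset_starI _ _ _)
  intro x hx
  constructor
  · exact dddd _ _ (idealSub_anti (idealSub_anti (fun y (hy : y ∈ starI S I K) => hy.1)) hx.1)
  · exact dddd _ _ (idealSub_anti (idealSub_anti (fun y (hy : y ∈ starI S I K) => hy.2)) hx.2)

theorem dd_transl (I K : Set ℤ) (a x : ℤ) :
    a + x ∈ idealSub I (idealSub I ((fun x => a + x) '' K)) ↔ x ∈ idealSub I (idealSub I K) := by
  constructor
  · intro h y hy
    have := h (y - a) (by
      rintro _ ⟨k, hk, rfl⟩
      have := hy k hk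
      convert this using 1; ring)
    convert this using 1; ring
  · intro h y hy
    have := h (y + a) (by
      intro k hk
      have := hy (a + k) ⟨k, hk, rfl⟩
      convert this using 1; ring)
    convert this using 1; ring

theorem starI_transl (S : NumSgp) (I K : Set ℤ) (a : ℤ) :
    starI S I ((fun x => a + x) '' K) = (fun x => a + x) '' starI S I K := by
  ext x
  have hx : x = a + (x - a) := by ring
  constructor
  · intro h
    rw [hx] at h
    exact ⟨x - a, ⟨(dd_transl _ _ _ _).1 h.1, (dd_transl _ _ _ _).1 h.2⟩, hx.symm⟩
  · rintro ⟨y, hy, rfl⟩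
    exact ⟨(dd_transl _ _ _ _).2 hy.1, (dd_transl _ _ _ _).2 hy.2⟩

theorem frac_transl {S : NumSgp} {K : Set ℤ} (h : IsFracIdeal S K) (a : ℤ) :
    IsFracIdeal S ((fun x => a + x) '' K) := by
  obtain ⟨h1, ⟨l, hl⟩, h3⟩ := h
  refine ⟨h1.image _, ⟨a + l, ?_⟩, ?_⟩
  · rintro _ ⟨k, hk, rfl⟩
    have := hl hk
    simpa using this
  · rintro _ ⟨k, hk, rfl⟩ s hs
    exact ⟨k + s, h3 k hk s hs, by ring⟩

theorem starI_frac {S : NumSgp} {I K : Set ℤ} (hI : IsFracIdeal S I) (hK : IsFracIdeal S K) :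
    IsFracIdeal S (starI S I K) := by
  refine ⟨hK.1.mono (subset_starI _ _ _), ?_, ?_⟩
  · obtain ⟨l, hl⟩ := hK.2.1
    refine ⟨-((frob S : ℤ) + 1 - l), ?_⟩
    intro x hx
    have := natS_nonneg (hx.1 ((frob S : ℤ) + 1 - l) (by
      intro k hk
      have := hl hk
      exact gt_frob_natS (by omega)))
    omega
  · intro x hx s hs
    constructor
    · intro y hy
      have := natS_add (hx.1 y hy) hs
      convert this using 1; ring
    · intro y hy
      have := hI.2.2 _ (hx.2 y hy) s hs
      convert this using 1; ring

open Classical in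
/-- The star operation generated by `I`, as a `StarOp`. -/
noncomputable def starOpI (S : NumSgp) (I : Set ℤ) (hI : IsFracIdeal S I) : StarOp S where
  toFun K := if IsFracIdeal S K then starI S I K else K
  isFrac K hK := by simpa [hK] using starI_frac hI hK
  subset_star K hK := by simpa [hK] using subset_starI S I K
  mono K L hK hL h := by simpa [hK, hL] using starI_mono S I h
  idem K hK := by simp [hK, starI_frac hI hK, starI_idem]
  transl K hK a := by simp only [hK, frac_transl hK a, if_true, starI_transl]
  star_S := by
    rw [if_pos (natS_isFrac S)]
    refine Set.Subset.antisymm ?_ (subset_starI _ _ _)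
    intro x hx
    simpa using hx.1 0 (fun y hy => by simpa using hy)
  default_eq K hK := by simp [hK]

theorem starOpI_apply {S : NumSgp} {I K : Set ℤ} (hI : IsFracIdeal S I)
    (hK : IsFracIdeal S K) : (starOpI S I hI).toFun K = starI S I K := by
  simp [starOpI, hK]

/-- A star operation that closes `I` is contained in the closure by `I`. -/
theorem sub_dd_of_closed {S : NumSgp} (t : StarOp S) {I : Set ℤ} (hI : IsFracIdeal S I)
    (h : t.toFun I = I) {K : Set ℤ} (hK : IsFracIdeal S K) :
    t.toFun K ⊆ idealSub I (idealSub I K) := by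
  intro y hy x hx
  have h1 : (fun z => x + z) '' K ⊆ I := by
    rintro _ ⟨k, hk, rfl⟩
    exact hx k hk
  have h2 := t.mono _ _ (frac_transl hK x) hI h1
  rw [t.transl K hK x, h] at h2
  rw [add_comm]
  exact h2 ⟨y, hy, rfl⟩

theorem star_sub_starI {S : NumSgp} (t : StarOp S) {I : Set ℤ} (hI : IsFracIdeal S I)
    (h : t.toFun I = I) {K : Set ℤ} (hK : IsFracIdeal S K) :
    t.toFun K ⊆ starI S I K :=
  fun _ hx => ⟨sub_dd_of_closed t (natS_isFrac S) t.star_S hK hx, sub_dd_of_closed t hI h hK hx⟩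

theorem starI_self_sub {S : NumSgp} {I : Set ℤ} : starI S I I ⊆ I := by
  intro x hx
  simpa using hx.2 0 (fun y hy => by simpa using hy)

/-- `S ∪ {g}` is a fractional ideal. -/
theorem I_frac (S : NumSgp) : IsFracIdeal S (natS S ∪ {(frob S : ℤ)}) := by
  refine ⟨⟨0, Or.inl (natS_zero S)⟩, ⟨0, ?_⟩, ?_⟩
  · rintro x (hx | rfl)
    · exact natS_nonneg hx
    · positivity
  · rintro x (hx | rfl) s hs
    · exact Or.inl (natS_add hx hs)
    · rcases (natS_nonneg hs).eq_or_lt with h | h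
      · right; simp [← h]
      · left; exact gt_frob_natS (by omega)

theorem I_F0 (S : NumSgp) : (natS S ∪ {(frob S : ℤ)}) ∈ F0 S := by
  refine ⟨I_frac S, Set.subset_union_left, ?_⟩
  rintro x (hx | rfl)
  · exact natS_nonneg hx
  · simp

/-- The backward direction. -/
theorem backward (S : NumSgp) (h : S.carrier = {0} ∪ {x : ℕ | 4 ≤ x}) :
    AtomIdeal S (natS S ∪ {(frob S : ℤ)}) := by
  have hf : frob S = 3 := by
    have h3 : S.carrierᶜ.Nonempty := ⟨3, by simp [h]⟩
    have h1 := frob_not_mem h3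
    have h2 : 3 ≤ frob S := le_csSup S.cofinite.bddAbove (by simp [h])
    simp [h] at h1
    omega
  have hS : ∀ x : ℤ, x ∈ natS S ↔ x = 0 ∨ 4 ≤ x := by
    intro x
    rw [mem_natS, h]
    constructor
    · rintro ⟨n, hn, rfl⟩
      simp at hn
      omega
    · intro hx
      refine ⟨x.toNat, ?_, by omega⟩
      simp
      omega
  refine ⟨I_F0 S, ?_⟩
  have hIf := I_frac S
  set I : Set ℤ := natS S ∪ {(frob S : ℤ)} with hIdef
  have hI : ∀ x : ℤ, x ∈ I ↔ x = 0 ∨ 3 ≤ x := by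
    intro x
    simp only [hIdef, Set.mem_union, Set.mem_singleton_iff, hS, hf]
    push_cast
    omega
  have key : ∀ t : StarOp S, t.toFun I ≠ I → (2 : ℤ) ∈ t.toFun I := by
    intro t ht
    have hsub := t.subset_star I hIf
    obtain ⟨y, hy, hyI⟩ : ∃ y ∈ t.toFun I, y ∉ I := by
      by_contra hc
      push Not at hc
      exact ht (Set.Subset.antisymm hc hsub)
    have hy0 : 0 ≤ 4 + y := by
      have := sub_dd_of_closed t (natS_isFrac S) t.star_S hIf hy 4 (by
        intro j hj
        rw [hI] at hj
        rw [hS]; omega)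
      rw [add_comm]; exact natS_nonneg this
    have hy1 : 0 ≤ y := by
      by_contra hneg
      have hy' := sub_dd_of_closed t (natS_isFrac S) t.star_S hIf hy
      have h4 := hy' 4 (by
        intro j hj
        rw [hI] at hj
        rw [hS]; omega)
      have h5 := hy' 5 (by
        intro j hj
        rw [hI] at hj
        rw [hS]; omega)
      rw [hS] at h4 h5
      omega
    rw [hI] at hyI
    rcases (show y = 1 ∨ y = 2 by omega) with rfl | rfl
    · have hK := t.isFrac I hIf
      have hsub2 : I ⊆ (fun x => (-1 : ℤ) + x) '' t.toFun I := by
        intro x hx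
        refine ⟨x + 1, ?_, by ring⟩
        rcases (hI x).1 hx with rfl | hx
        · simpa using hy
        · exact hsub ((hI _).2 (by omega))
      have h2 := t.mono _ _ hIf (frac_transl hK (-1)) hsub2
      rw [t.transl _ hK, t.idem I hIf] at h2
      obtain ⟨z, hz, hz1⟩ := h2 hy
      have : z = 2 := by simp at hz1; omega
      exact this ▸ hz
    · exact hy
  intro t u htu
  by_cases h1 : t.toFun I = I
  · exact Or.inl fun J hJ => star_sub_starI t hIf h1 hJ
  by_cases h2 : u.toFun I = I
  · exact Or.inr fun J hJ => star_sub_starI u hIf h2 hJ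
  exfalso
  have := starI_self_sub (htu I hIf ⟨key t h1, key u h2⟩)
  rw [hI] at this
  omega

/-- `S ∪ {g, a}` is an ideal. -/
theorem Ja_frac (S : NumSgp) (a : ℕ)
    (haT : ∀ s ∈ S.carrier, s ≠ 0 → a + s ∈ S.carrier) :
    IsFracIdeal S (natS S ∪ {(frob S : ℤ)} ∪ {(a : ℤ)}) := by
  have hI := I_frac S
  refine ⟨⟨0, Or.inl (Or.inl (natS_zero S))⟩, ⟨0, ?_⟩, ?_⟩
  · rintro x (hx | rfl)
    · exact (I_F0 S).2.2 hx
    · positivity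
  · rintro x (hx | rfl) s hs
    · exact Or.inl (hI.2.2 _ hx _ hs)
    · obtain ⟨n, hn, rfl⟩ := mem_natS.1 hs
      rcases eq_or_ne n 0 with rfl | h
      · right; simp
      · left; left
        exact_mod_cast natS_cast.2 (haT n hn h)

theorem a_mem (S : NumSgp) (hne : S.carrierᶜ.Nonempty) (a : ℕ) (ha0 : 0 < a)
    (haT : ∀ s ∈ S.carrier, s ≠ 0 → a + s ∈ S.carrier)
    (ha2 : 2 * a ∈ S.carrier ∨ 2 * a = frob S) :
    (a : ℤ) ∈ starI S (natS S ∪ {(frob S : ℤ)} ∪ {(a : ℤ)}) (natS S ∪ {(frob S : ℤ)}) := by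
  constructor
  · intro x hx
    have h0 := hx 0 (Or.inl (natS_zero S))
    rw [add_zero] at h0
    obtain ⟨n, hn, rfl⟩ := mem_natS.1 h0
    have hg := hx (frob S) (Or.inr rfl)
    have hn0 : n ≠ 0 := by
      rintro rfl
      simp only [Nat.cast_zero, zero_add] at hg
      exact frob_not_mem hne (natS_cast.1 hg)
    exact_mod_cast natS_cast.2 (haT n hn hn0)
  · intro x hx
    have h0 := hx 0 (Or.inl (natS_zero S))
    rw [add_zero] at h0
    rcases h0 with (h0 | h0) | h0
    · obtain ⟨n, hn, rfl⟩ := mem_natS.1 h0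
      rcases eq_or_ne n 0 with rfl | h
      · right; simp
      · left; left
        exact_mod_cast natS_cast.2 (haT n hn h)
    · rw [Set.mem_singleton_iff] at h0
      subst h0
      left; left
      exact gt_frob_natS (by omega)
    · rw [Set.mem_singleton_iff] at h0
      subst h0
      left
      rcases ha2 with h | h
      · left
        have := natS_cast.2 h
        convert this using 1; push_cast; ring
      · right
        rw [Set.mem_singleton_iff, ← h]; push_cast; ring

theorem not_atom (S : NumSgp) (hne : S.carrierᶜ.Nonempty) (a b : ℕ) (hab : a ≠ b)
    (ha0 : 0 < a) (hb0 : 0 < b) (haS : a ∉ S.carrier) (hbS : b ∉ S.carrier)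
    (hag : a ≠ frob S) (hbg : b ≠ frob S)
    (haT : ∀ s ∈ S.carrier, s ≠ 0 → a + s ∈ S.carrier)
    (hbT : ∀ s ∈ S.carrier, s ≠ 0 → b + s ∈ S.carrier)
    (ha2 : 2 * a ∈ S.carrier ∨ 2 * a = frob S)
    (hb2 : 2 * b ∈ S.carrier ∨ 2 * b = frob S) :
    ¬ AtomIdeal S (natS S ∪ {(frob S : ℤ)}) := by
  rintro ⟨-, h⟩
  have hIf := I_frac S
  have hA := Ja_frac S a haT
  have hB := Ja_frac S b hbT
  have notI : ∀ c : ℕ, c ∉ S.carrier → c ≠ frob S → (c : ℤ) ∉ natS S ∪ {(frob S : ℤ)} := by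
    rintro c hc hcg (h | h)
    · exact hc (natS_cast.1 h)
    · exact hcg (by simpa using h)
  rcases h (starOpI S _ hA) (starOpI S _ hB) (by
    intro K hK
    rw [starOpI_apply hA hK, starOpI_apply hB hK]
    rintro y ⟨hy1, hy2⟩
    refine ⟨hy1.1, fun x hx => ?_⟩
    have h1 := hy1.2 x (fun k hk => Or.inl (hx k hk))
    have h2 := hy2.2 x (fun k hk => Or.inl (hx k hk))
    rcases h1 with h1 | h1
    · exact h1
    rcases h2 with h2 | h2
    · exact h2
    rw [Set.mem_singleton_iff] at h1 h2
    exact absurd (by exact_mod_cast h1.symm.trans h2) hab) with h | h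
  · have := h _ hIf
    rw [starOpI_apply hA hIf] at this
    exact notI a haS hag (starI_self_sub (this (a_mem S hne a ha0 haT ha2)))
  · have := h _ hIf
    rw [starOpI_apply hB hIf] at this
    exact notI b hbS hbg (starI_self_sub (this (a_mem S hne b hb0 hbT hb2)))

theorem T_elim {S : NumSgp} {x : ℤ} (h : x ∈ Tset S) :
    (∀ s ∈ S.carrier, s ≠ 0 → x + s ∈ natS S) ∧ x ∉ natS S :=
  ⟨fun s hs h0 => h.1 s ⟨s, ⟨hs, by simpa using h0⟩, rfl⟩, h.2⟩

theorem T_range {S : NumSgp} (hne : S.carrierᶜ.Nonempty) {x : ℤ} (h : x ∈ Tset S) :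
    1 ≤ x ∧ x ≤ frob S := by
  obtain ⟨h1, h2⟩ := T_elim h
  have hm := mult_mem S
  have hm0 : multNum S ≠ 0 := by simpa using hm.2
  constructor
  · by_contra hx
    have hx0 : x ≠ 0 := by rintro rfl; exact h2 (natS_zero S)
    obtain ⟨n, hn, hnx⟩ := mem_natS.1 (h1 _ hm.1 hm0)
    have hn0 : n = 0 := by
      by_contra hn0
      have := mult_le hn hn0
      omega
    have hg := h1 (frob S + multNum S) (gt_frob_mem (by omega)) (by omega)
    have : x + ((frob S + multNum S : ℕ) : ℤ) = (frob S : ℤ) := by push_cast; omega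
    rw [this] at hg
    exact frob_not_mem hne (natS_cast.1 hg)
  · by_contra hx
    exact h2 (gt_frob_natS (by omega))

theorem compl_nonempty {S : NumSgp} (ht : 3 ≤ typeNum S) : S.carrierᶜ.Nonempty := by
  by_contra hne
  rw [Set.not_nonempty_iff_eq_empty, Set.compl_empty_iff] at hne
  have hsub : Tset S ⊆ {(-1 : ℤ)} := by
    intro x hx
    obtain ⟨h1, h2⟩ := T_elim hx
    have h3 := natS_nonneg (h1 1 (by simp [hne]) (by simp))
    have h4 : ¬ 0 ≤ x := fun h => h2 (mem_natS.2 ⟨x.toNat, by simp [hne], by omega⟩)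
    simp only [Set.mem_singleton_iff]
    push_cast at h3
    omega
  have := Set.ncard_le_ncard hsub (Set.finite_singleton _)
  rw [Set.ncard_singleton] at this
  unfold typeNum at ht
  omega

theorem T_pair {S : NumSgp} (ht : 3 ≤ typeNum S) (u v : ℤ) (h : Tset S ⊆ {u, v}) : False := by
  have h1 := Set.ncard_le_ncard h (Set.toFinite _)
  have h2 := Set.ncard_insert_le u {v}
  rw [Set.ncard_singleton] at h2
  unfold typeNum at ht
  omega

theorem forward (S : NumSgp) (ht : 3 ≤ typeNum S)
    (hg : frob S + 2 ≤ 2 * multNum S) (hat : AtomIdeal S (natS S ∪ {(frob S : ℤ)})) :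
    S.carrier = {0} ∪ {x : ℕ | 4 ≤ x} := by
  have hne := compl_nonempty ht
  have hgS := frob_not_mem hne
  have hm := mult_mem S
  have hm0 : multNum S ≠ 0 := by simpa using hm.2
  have hmS := hm.1
  have hgt : ∀ n, frob S < n → n ∈ S.carrier := fun n h => gt_frob_mem h
  have hle : ∀ n ∈ S.carrier, n ≠ 0 → multNum S ≤ n := fun n h h0 => mult_le h h0
  have hT : ∀ x ∈ Tset S, 1 ≤ x ∧ x ≤ frob S := fun x hx => T_range hne hx
  have hna := fun a b => not_atom S hne a b
  have hTe : ∀ x ∈ Tset S, _ := fun x hx => T_elim hx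
  have h0S := S.zero_mem
  generalize frob S = g at *
  generalize multNum S = m at *
  have hg0 : g ≠ 0 := by rintro rfl; exact hgS h0S
  have hlow : ∀ n, 0 < n → n < m → n ∉ S.carrier := fun n h1 h2 h3 => by
    have := hle n h3 (by omega)
    omega
  have hgm : m ≤ g + 1 := by
    have := hle (g + 1) (hgt _ (by omega)) (by omega)
    omega
  have hgm' : g ≠ m := by rintro rfl; exact hgS hmS
  -- a packaged criterion
  have crit : ∀ a b : ℕ, a ≠ b → 0 < a → 0 < b → a ∉ S.carrier → b ∉ S.carrier →
      a ≠ g → b ≠ g → g < a + m → g < b + m → (2 * a ∈ S.carrier ∨ 2 * a = g) →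
      (2 * b ∈ S.carrier ∨ 2 * b = g) → False := by
    intro a b hab ha hb haS hbS hag hbg h1 h2 h3 h4
    refine hna a b hab ha hb haS hbS hag hbg ?_ ?_ h3 h4 hat
    · intro s hs hs0
      have := hle s hs hs0
      exact hgt _ (by omega)
    · intro s hs hs0
      have := hle s hs hs0
      exact hgt _ (by omega)
  have dbl : ∀ a, g ≤ 2 * a → (2 * a ∈ S.carrier ∨ 2 * a = g) := by
    intro a ha
    rcases ha.eq_or_lt with h | h
    · exact Or.inr h.symm
    · exact Or.inl (hgt _ h)
  by_cases hcase : g + 1 = m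
  · by_cases h5 : 5 ≤ m
    · exact (crit (m - 2) (m - 3) (by omega) (by omega) (by omega)
        (hlow _ (by omega) (by omega)) (hlow _ (by omega) (by omega)) (by omega) (by omega)
        (by omega) (by omega) (dbl _ (by omega)) (dbl _ (by omega))).elim
    · by_cases h4 : m = 4
      · ext n
        simp only [Set.mem_union, Set.mem_singleton_iff, Set.mem_ofPred_eq]
        constructor
        · intro hn
          by_cases hn0 : n = 0
          · exact Or.inl hn0
          · have := hle n hn hn0
            right; omega
        · rintro (rfl | h)
          · exact h0S
          · exact hgt _ (by omega)
      · exfalso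
        apply T_pair ht 1 2
        intro x hx
        have := hT x hx
        simp only [Set.mem_insert_iff, Set.mem_singleton_iff]
        omega
  · exfalso
    by_cases h4 : g + 4 ≤ 2 * m
    · exact crit (m - 1) (m - 2) (by omega) (by omega) (by omega)
        (hlow _ (by omega) (by omega)) (hlow _ (by omega) (by omega)) (by omega) (by omega)
        (by omega) (by omega) (dbl _ (by omega)) (dbl _ (by omega))
    · by_cases hc : ∃ c, m ≤ c ∧ c < g ∧ c ∉ S.carrier
      · obtain ⟨c, hc1, hc2, hcS⟩ := hc
        exact crit (m - 1) c (by omega) (by omega) (by omega)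
          (hlow _ (by omega) (by omega)) hcS (by omega) (by omega)
          (by omega) (by omega) (dbl _ (by omega)) (dbl _ (by omega))
      · push Not at hc
        by_cases h3 : g + 3 = 2 * m
        · exact crit (m - 1) (m - 2) (by omega) (by omega) (by omega)
            (hlow _ (by omega) (by omega)) (hlow _ (by omega) (by omega)) (by omega) (by omega)
            (by omega) (by omega) (dbl _ (by omega)) (Or.inl (hc _ (by omega) (by omega)))
        · apply T_pair ht ((m : ℤ) - 1) g
          intro x hx
          obtain ⟨hx1, hx2⟩ := hT x hx
          obtain ⟨hx3, hx4⟩ := hTe x hx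
          simp only [Set.mem_insert_iff, Set.mem_singleton_iff]
          by_contra hcon
          push Not at hcon
          lift x to ℕ using (by omega)
          by_cases hxm : m ≤ x
          · exact hx4 (natS_cast.2 (hc x hxm (by omega)))
          · have := hx3 (g - x) (hc _ (by omega) (by omega)) (by omega)
            have he : (x : ℤ) + ((g - x : ℕ) : ℤ) = (g : ℤ) := by omega
            rw [he] at this
            exact hgS (natS_cast.1 this)

/-- If `t(S) ≥ 3` and `g(S) ≤ 2μ(S) − 2`, then `S ∪ {g}` is an atom of `G₀(S)`
if and only if `S = ⟨4,5,6,7⟩ = {0} ∪ {x ∈ ℕ : x ≥ 4}`. -/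
theorem atom_S_union_g_iff (S : NumSgp) (ht : 3 ≤ typeNum S)
    (hg : frob S + 2 ≤ 2 * multNum S) :
    AtomIdeal S (natS S ∪ {(frob S : ℤ)}) ↔ S.carrier = {0} ∪ {x : ℕ | 4 ≤ x} :=
  ⟨forward S ht hg, backward S⟩
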